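/- arXiv:2409.11091 — 3 statements merged into one kernel-verified Lean document; each statement's English description precedes it below -/
import Mathlib

section
/- For every profile v = (v_1,…,v_n) of XOS valuations, the welfare G(v) of the allocation output by the buyer-wise greedy algorithm is at least half the optimal offline welfare: OPT(v) ≤ 2·G(v). -/
open scoped BigOperators

/-- A valuation is a real-valued set function on bundles of the `m` items. -/
abbrev Val (m : ℕ) := Finset (Fin m) → ℝ

/-- A (normalized, monotone) valuation. -/
def IsValuation {m : ℕ} (v : Val m) : Prop :=
  v ∅ = 0 ∧ ∀ A B : Finset (Fin m), A ⊆ B → v A ≤ v B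

/-- XOS (fractionally subadditive) valuations: a pointwise maximum of finitely many
nonnegative additive functions. -/
def IsXOS {m : ℕ} (v : Val m) : Prop :=
  ∃ (k : ℕ) (a : Fin (k + 1) → Fin m → ℝ),
    (∀ ℓ j, 0 ≤ a ℓ j) ∧ ∀ B : Finset (Fin m), v B = ⨆ ℓ, ∑ j ∈ B, a ℓ j

/-- An allocation: pairwise disjoint bundles. -/
def IsAlloc {n m : ℕ} (A : Fin n → Finset (Fin m)) : Prop :=
  ∀ i i' : Fin n, i ≠ i' → Disjoint (A i) (A i')

/-- The optimal offline welfare of a valuation profile. -/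
noncomputable def OPT {n m : ℕ} (v : Fin n → Val m) : ℝ :=
  ⨆ A : {A : Fin n → Finset (Fin m) // IsAlloc A}, ∑ i, v i (A.1 i)

/-- `B` is a demand set of valuation `v` at prices `p` among the available items `M`:
it maximizes the utility `v(B) - Σ_{j ∈ B} p j` over subsets of `M`. -/
def IsDemand {m : ℕ} (v : Val m) (p : Fin m → ℝ) (M : Finset (Fin m))
    (B : Finset (Fin m)) : Prop :=
  B ⊆ M ∧ ∀ B' ⊆ M, v B' - ∑ j ∈ B', p j ≤ v B - ∑ j ∈ B, p j

/-- `a` is an additive supporting function of `v` on `B`. -/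
def IsSupport {m : ℕ} (v : Val m) (B : Finset (Fin m)) (a : Fin m → ℝ) : Prop :=
  (∀ j, 0 ≤ a j) ∧ (∀ j, j ∉ B → a j = 0) ∧
  (∀ B' : Finset (Fin m), ∑ j ∈ B', a j ≤ v B') ∧ ∑ j ∈ B, a j = v B

/-- The least power of two that is at least `x` (by convention `0` for `x ≤ 0`). -/
noncomputable def pow2ceil (x : ℝ) : ℝ :=
  if x ≤ 0 then 0 else (2 : ℝ) ^ (⌈Real.logb 2 x⌉ : ℤ)

/-- At a demand set, the supporting value of each demanded item is at least its price. -/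
lemma IsDemand.price_le_support {m : ℕ} {v : Val m} {p a : Fin m → ℝ}
    {M B : Finset (Fin m)} (hd : IsDemand v p M B) (hs : IsSupport v B a)
    {j : Fin m} (hj : j ∈ B) : p j ≤ a j := by
  have hutil := hd.2 (B.erase j) ((B.erase_subset j).trans hd.1)
  have hval := hs.2.2.1 (B.erase j)
  have hp := Finset.add_sum_erase B p hj
  have ha := Finset.add_sum_erase B a hj
  linarith [hs.2.2.2]

/-- At every time, a price is either still `0` or the supporting value of the last buyer
who took the item. -/
lemma price_eq_zero_or_last_support {n m : ℕ} {A : Fin n → Finset (Fin m)}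
    {a : Fin n → Fin m → ℝ} {p : Fin (n + 1) → Fin m → ℝ} (hp0 : ∀ j, p 0 j = 0)
    (hupd : ∀ (i : Fin n) (j : Fin m),
      p i.succ j = if j ∈ A i then a i j else p i.castSucc j)
    (j : Fin m) (k : Fin (n + 1)) :
    p k j = 0 ∨ ∃ i : Fin n, j ∈ A i ∧ p k j = a i j ∧
      ∀ i' : Fin n, i < i' → i'.castSucc < k → j ∉ A i' := by
  induction k using Fin.induction with
  | zero => exact Or.inl (hp0 j)
  | succ k ih =>
    rw [hupd]
    split_ifs with hj
    · refine Or.inr ⟨k, hj, rfl, fun i' hlt hle => ?_⟩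
      exact absurd (Fin.castSucc_lt_succ_iff.mp hle) (not_le.mpr hlt)
    · refine ih.imp_right fun ⟨i, hi, hpi, hlast⟩ => ⟨i, hi, hpi, fun i' hlt hle => ?_⟩
      rcases (Fin.castSucc_lt_succ_iff.mp hle).lt_or_eq with h | rfl
      · exact hlast i' hlt (Fin.castSucc_lt_castSucc_iff.mpr h)
      · exact hj

/-- The final prices are covered by the welfare of the final allocation. -/
lemma sum_last_price_le_welfare {n m : ℕ} {v : Fin n → Val m} {A : Fin n → Finset (Fin m)}
    {a : Fin n → Fin m → ℝ} {p : Fin (n + 1) → Fin m → ℝ} (hp0 : ∀ j, p 0 j = 0)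
    (hsupp : ∀ i, IsSupport (v i) (A i) (a i))
    (hupd : ∀ (i : Fin n) (j : Fin m),
      p i.succ j = if j ∈ A i then a i j else p i.castSucc j) :
    ∑ j, p (Fin.last n) j ≤
      ∑ i, v i (A i \ (Finset.univ.filter fun i' => i < i').biUnion A) := by
  set F : Fin n → Finset (Fin m) :=
    fun i => A i \ (Finset.univ.filter fun i' => i < i').biUnion A with hF
  have hnonneg : ∀ j i, 0 ≤ if j ∈ F i then a i j else 0 := fun j i => by
    split_ifs
    exacts [(hsupp i).1 j, le_rfl]
  calc ∑ j, p (Fin.last n) j ≤ ∑ j, ∑ i, if j ∈ F i then a i j else 0 := by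
        refine Finset.sum_le_sum fun j _ => ?_
        rcases price_eq_zero_or_last_support hp0 hupd j (Fin.last n) with h | ⟨i, hi, hpi, hlast⟩
        · exact h.trans_le (Finset.sum_nonneg fun i _ => hnonneg j i)
        · have hmem : j ∈ F i := by
            simp only [hF, Finset.mem_sdiff, Finset.mem_biUnion, Finset.mem_filter,
              Finset.mem_univ, true_and, not_exists, not_and]
            exact ⟨hi, fun i' hlt => hlast i' hlt (Fin.castSucc_lt_last i')⟩
          have hle := Finset.single_le_sum (fun i _ => hnonneg j i) (Finset.mem_univ i)
          rwa [if_pos hmem, ← hpi] at hle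
    _ = ∑ i, ∑ j ∈ F i, a i j := by
        rw [Finset.sum_comm]
        simp
    _ ≤ ∑ i, v i (F i) := Finset.sum_le_sum fun i _ => (hsupp i).2.2.1 (F i)

/-- The buyer-wise greedy algorithm is a `2`-approximation to the
optimal offline welfare for XOS valuations.  The run of the algorithm is described by
the demand sets `A i` chosen for the buyers, the additive supporting functions `a i`
of `v i` on `A i`, and the price trajectories `p`: prices start at `0`, buyer `i`
takes a demand set `A i` at the prices `p i.castSucc` over all items (re-assigning
items taken from earlier buyers), and the price of every `j ∈ A i` is raised to its
supporting value `a i j`.  Buyer `i` finally keeps `A i` minus everything re-assigned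
to later buyers. -/
theorem stmt3 {n m : ℕ} (v : Fin n → Val m)
    (hv : ∀ i, IsValuation (v i) ∧ IsXOS (v i))
    (A : Fin n → Finset (Fin m)) (a : Fin n → Fin m → ℝ)
    (p : Fin (n + 1) → Fin m → ℝ)
    (hp0 : ∀ j, p 0 j = 0)
    (hdem : ∀ i, IsDemand (v i) (p i.castSucc) Finset.univ (A i))
    (hsupp : ∀ i, IsSupport (v i) (A i) (a i))
    (hupd : ∀ (i : Fin n) (j : Fin m),
      p i.succ j = if j ∈ A i then a i j else p i.castSucc j) :
    OPT v ≤ 2 * ∑ i, v i (A i \ (Finset.univ.filter fun i' => i < i').biUnion A) := by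
  have hmono : Monotone p := Fin.monotone_iff_le_succ.mpr fun i j => by
    rw [hupd]
    split_ifs with hj
    exacts [(hdem i).price_le_support (hsupp i) hj, le_rfl]
  have hnonneg : ∀ j, 0 ≤ p (Fin.last n) j := fun j =>
    (hp0 j).ge.trans (hmono (Fin.zero_le _) j)
  have hutil : ∀ i, v i (A i) - ∑ j ∈ A i, p i.castSucc j =
      ∑ j, p i.succ j - ∑ j, p i.castSucc j := fun i => by
    rw [← (hsupp i).2.2.2, ← Finset.sum_sub_distrib, ← Finset.sum_sub_distrib,
      ← Finset.sum_subset (Finset.subset_univ (A i))]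
    · exact Finset.sum_congr rfl fun j hj => by rw [hupd, if_pos hj]
    · intro j _ hj
      rw [hupd, if_neg hj, sub_self]
  have htele : ∑ i : Fin n, (∑ j, p i.succ j - ∑ j, p i.castSucc j) =
      ∑ j, p (Fin.last n) j := by
    have hsucc := Fin.sum_univ_succ fun k => ∑ j, p k j
    have hcast := Fin.sum_univ_castSucc fun k => ∑ j, p k j
    have hzero : ∑ j, p 0 j = 0 := Finset.sum_eq_zero fun j _ => hp0 j
    rw [Finset.sum_sub_distrib]
    linarith
  have hwelfare := sum_last_price_le_welfare hp0 hsupp hupd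
  have : Nonempty {O : Fin n → Finset (Fin m) // IsAlloc O} :=
    ⟨⟨fun _ => ∅, fun _ _ _ => Finset.disjoint_empty_left _⟩⟩
  refine ciSup_le fun ⟨O, hO⟩ => ?_
  have hbuyer : ∀ i, v i (O i) ≤
      (∑ j, p i.succ j - ∑ j, p i.castSucc j) + ∑ j ∈ O i, p (Fin.last n) j := fun i => by
    have hle : ∑ j ∈ O i, p i.castSucc j ≤ ∑ j ∈ O i, p (Fin.last n) j :=
      Finset.sum_le_sum fun j _ => hmono (Fin.le_last _) j
    linarith [(hdem i).2 (O i) (Finset.subset_univ _), hutil i]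
  have hprices : ∑ i, ∑ j ∈ O i, p (Fin.last n) j ≤ ∑ j, p (Fin.last n) j := by
    rw [← Finset.sum_biUnion fun i _ i' _ hne => hO i i' hne]
    exact Finset.sum_le_sum_of_subset_of_nonneg (Finset.subset_univ _) fun j _ _ => hnonneg j
  have hsum := Finset.sum_le_sum fun i (_ : i ∈ Finset.univ) => hbuyer i
  rw [Finset.sum_add_distrib, htele] at hsum
  linarith
end

section
/- In the two-samples algorithm, assuming all additive supporting values are distinct, for every item j ∈ [m]: E[ALG_j] ≥ (1/4)·E[max( max_{i: j∈B_i} a_j(r_i,B_i), max_{i: j∈A'_i} a_j(s'_i,A'_i) )], where the expectation is over the random assignment of the adversary's three valuation functions per buyer to s, s', r. -/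
open scoped BigOperators

variable {n m : ℕ}

/-- The first sample profile determined by the assignment `σ`. -/
def sP (V : Fin n → Fin 3 → Val m) (σ : Fin n → Equiv.Perm (Fin 3)) : Fin n → Val m :=
  fun i => V i (σ i 0)

/-- The second sample profile determined by the assignment `σ`. -/
def tP (V : Fin n → Fin 3 → Val m) (σ : Fin n → Equiv.Perm (Fin 3)) : Fin n → Val m :=
  fun i => V i (σ i 1)

/-- The actual valuation profile determined by the assignment `σ`. -/
def rP (V : Fin n → Fin 3 → Val m) (σ : Fin n → Equiv.Perm (Fin 3)) : Fin n → Val m :=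
  fun i => V i (σ i 2)

section TwoSamples

variable (d : (Fin m → ℝ) → Val m → Finset (Fin m))
  (asup : Val m → Finset (Fin m) → Fin m → ℝ)
  (p : (Fin n → Val m) → Fin (n + 1) → Fin m → ℝ)
  (V : Fin n → Fin 3 → Val m)

/-- `A' i`: the demand set of the second sample `s'_i` at the prices `p^(i)` set by
the modified buyer-wise greedy algorithm run on the first sample `s`. -/
def Aset (σ : Fin n → Equiv.Perm (Fin 3)) (i : Fin n) : Finset (Fin m) :=
  d (p (sP V σ) i.castSucc) (tP V σ i)

/-- `B i`: the demand set of the actual valuation `r_i` at the prices `p^(i)` set by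
the modified buyer-wise greedy algorithm run on the first sample `s`. -/
def Bset (σ : Fin n → Equiv.Perm (Fin 3)) (i : Fin n) : Finset (Fin m) :=
  d (p (sP V σ) i.castSucc) (rP V σ i)

/-- The base price `b j`: the largest contribution of item `j` to any of the demand
bundles `A' i` of the second sample (`0` if there is none). -/
noncomputable def basePrice (σ : Fin n → Equiv.Perm (Fin 3)) (j : Fin m) : ℝ :=
  ⨆ i : {i : Fin n // j ∈ Aset d p V σ i}, asup (tP V σ i.1) (Aset d p V σ i.1) j

/-- The set of items buyer `i` attempts to buy: the items of `B i` whose supporting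
value strictly exceeds the base price. -/
noncomputable def Cset (σ : Fin n → Equiv.Perm (Fin 3)) (i : Fin n) : Finset (Fin m) :=
  (Bset d p V σ i).filter fun j =>
    basePrice d asup p V σ j < asup (rP V σ i) (Bset d p V σ i) j

/-- The bundle actually allocated to buyer `i`: the still-available part of `C i`. -/
noncomputable def allocSet (σ : Fin n → Equiv.Perm (Fin 3)) (i : Fin n) :
    Finset (Fin m) :=
  (Cset d asup p V σ i).filter fun j => ∀ i' < i, j ∉ Cset d asup p V σ i'

/-- `ALG_j`: the contribution of item `j` to the algorithm's welfare, namely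
`a_j(r_i, B_i)` for the buyer `i` (if any) receiving item `j`, and `0` otherwise. -/
noncomputable def ALGj (σ : Fin n → Equiv.Perm (Fin 3)) (j : Fin m) : ℝ :=
  ∑ i : Fin n,
    if j ∈ allocSet d asup p V σ i then asup (rP V σ i) (Bset d p V σ i) j else 0

/-- `max_{i : j ∈ B i} a_j(r_i, B_i)` (`0` if there is no such `i`). -/
noncomputable def maxR (σ : Fin n → Equiv.Perm (Fin 3)) (j : Fin m) : ℝ :=
  ⨆ i : {i : Fin n // j ∈ Bset d p V σ i}, asup (rP V σ i.1) (Bset d p V σ i.1) j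

/-- `max_{i : j ∈ A' i} a_j(s'_i, A'_i)` (`0` if there is no such `i`). -/
noncomputable def maxS (σ : Fin n → Equiv.Perm (Fin 3)) (j : Fin m) : ℝ :=
  ⨆ i : {i : Fin n // j ∈ Aset d p V σ i}, asup (tP V σ i.1) (Aset d p V σ i.1) j

end TwoSamples

/-- Any real function on a nonempty finite type has a maximizer, and a second point that is
maximal away from the first one and differs from it unless the type is a singleton. -/
lemma exists_top_two {ι : Type*} [Finite ι] [Nonempty ι] (K : ι → ℝ) :
    ∃ ab : ι × ι, (∀ i, K i ≤ K ab.1) ∧ (∀ i, i ≠ ab.1 → ab.2 ≠ ab.1 ∧ K i ≤ K ab.2) := by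
  classical
  obtain ⟨a, ha⟩ := Finite.exists_max K
  by_cases h : ∃ i, i ≠ a
  · have : Nonempty {i // i ≠ a} := let ⟨i, hi⟩ := h; ⟨⟨i, hi⟩⟩
    obtain ⟨b, hb⟩ := Finite.exists_max fun i : {i // i ≠ a} => K i
    exact ⟨(a, b), ha, fun i hi => ⟨b.2, hb ⟨i, hi⟩⟩⟩
  · exact ⟨(a, a), ha, fun i hi => (h ⟨i, hi⟩).elim⟩

/-- Averaging over independent exchanges of the two bids of each bidder: if `F` collects the
top bid whenever that bid is an `R`-bid and the top bid of the remaining bidders is an `S`-bid,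
then on average `F` collects a quarter of the top bid. -/
lemma sum_top_bid_le_four_mul_sum {Ω ι : Type*} [Fintype Ω] [Finite ι] [Nonempty ι]
    [DecidableEq ι] (flip : ι → Ω → Ω) (hflip : ∀ i, Function.Involutive (flip i))
    (R S : Ω → ι → ℝ)
    (hR : ∀ i ω, R (flip i ω) = Function.update (R ω) i (S ω i))
    (hS : ∀ i ω, S (flip i ω) = Function.update (S ω) i (R ω i))
    (F M : Ω → ℝ) (hF : ∀ ω, 0 ≤ F ω)
    (hM : ∀ ω x, (∀ i, R ω i ≤ x ∧ S ω i ≤ x) → M ω ≤ x)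
    (hgood : ∀ ω a, (∀ i, R ω i ≤ R ω a ∧ S ω i ≤ R ω a) →
      (∀ i, i ≠ a → ∃ b, R ω i ≤ S ω b) → R ω a ≤ F ω) :
    ∑ ω, M ω ≤ 4 * ∑ ω, F ω := by
  choose top htop using fun K : ι → ℝ => exists_top_two K
  let K : Ω → ι → ℝ := fun ω i => max (R ω i) (S ω i)
  have hK : ∀ i ω, K (flip i ω) = K ω := by
    intro i ω
    funext k
    by_cases hk : k = i
    · subst hk
      simp [K, hR, hS, max_comm]
    · simp [K, hR, hS, hk]
  let φ : Ω → Ω := fun ω => flip (top (K ω)).1 ω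
  let ψ : Ω → Ω := fun ω => flip (top (K ω)).2 ω
  have hφ : Function.Involutive φ := by
    intro ω
    simp only [φ, hK]
    exact hflip _ ω
  have hψ : Function.Involutive ψ := by
    intro ω
    simp only [ψ, hK]
    exact hflip _ ω
  have sum_φ : ∀ G : Ω → ℝ, ∑ ω, G (φ ω) = ∑ ω, G ω := fun G => Equiv.sum_comp (hφ.toPerm φ) G
  have sum_ψ : ∀ G : Ω → ℝ, ∑ ω, G (ψ ω) = ∑ ω, G ω := fun G => Equiv.sum_comp (hψ.toPerm ψ) G
  have pointwise : ∀ ω, M ω ≤ F ω + F (φ ω) + F (ψ ω) + F (φ (ψ ω)) := by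
    intro ω
    obtain ⟨ha, hb⟩ := htop (K ω)
    have hφψ : φ (ψ ω) = flip (top (K ω)).1 (flip (top (K ω)).2 ω) := by
      simp only [φ, ψ, hK]
    have hφω : φ ω = flip (top (K ω)).1 ω := rfl
    have hψω : ψ ω = flip (top (K ω)).2 ω := rfl
    generalize (top (K ω)).1 = a at *
    generalize (top (K ω)).2 = b at *
    have hMa : M ω ≤ K ω a := hM ω _
      (fun i => ⟨(le_max_left _ _).trans (ha i), (le_max_right _ _).trans (ha i)⟩)
    have good : ∀ ω', K ω' = K ω → R ω' a = K ω a → (b ≠ a → S ω' b = K ω b) →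
        M ω ≤ F ω' := by
      intro ω' hω' hRa hSb
      refine hMa.trans (hRa ▸ hgood ω' a (fun i => ?_) fun i hi => ⟨b, ?_⟩)
      · rw [hRa, ← max_le_iff]
        exact (congrFun hω' i).le.trans (ha i)
      · obtain ⟨hba, hib⟩ := hb i hi
        rw [hSb hba]
        exact (le_max_left _ _).trans ((congrFun hω' i).le.trans hib)
    have h₀ := hF ω
    have h₁ := hF (φ ω)
    have h₂ := hF (ψ ω)
    have h₃ := hF (φ (ψ ω))
    have side : ∀ i, R ω i = K ω i ∨ S ω i = K ω i := fun i =>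
      (max_choice (R ω i) (S ω i)).imp Eq.symm Eq.symm
    rcases side a with hRa | hSa
    · by_cases hSb : b ≠ a → S ω b = K ω b
      · linarith [good ω rfl hRa hSb]
      · push Not at hSb
        have hRb := (side b).resolve_right hSb.2
        have := good (ψ ω) (by rw [hψω, hK])
          (by rw [hψω, hR, Function.update_of_ne hSb.1.symm, hRa])
          (fun _ => by rw [hψω, hS, Function.update_self, hRb])
        linarith
    · by_cases hSb : b ≠ a → S ω b = K ω b
      · have := good (φ ω) (by rw [hφω, hK]) (by rw [hφω, hR, Function.update_self, hSa])
          (fun hba => by rw [hφω, hS, Function.update_of_ne hba, hSb hba])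
        linarith
      · push Not at hSb
        have hRb := (side b).resolve_right hSb.2
        have := good (φ (ψ ω)) (by rw [hφψ, hK, hK])
          (by rw [hφψ, hR, Function.update_self, hS, Function.update_of_ne hSb.1.symm, hSa])
          (fun hba => by
            rw [hφψ, hS, Function.update_of_ne hba, hS, Function.update_self, hRb])
        linarith
  calc ∑ ω, M ω ≤ ∑ ω, (F ω + F (φ ω) + F (ψ ω) + F (φ (ψ ω))) :=
        Finset.sum_le_sum fun ω _ => pointwise ω
    _ = 4 * ∑ ω, F ω := by
        rw [Finset.sum_add_distrib, Finset.sum_add_distrib, Finset.sum_add_distrib, sum_φ,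
          sum_ψ, sum_ψ fun ω => F (φ ω), sum_φ]
        ring

/-- Exchange the second sample and the actual valuation of buyer `i`. -/
def exchange (i : Fin n) (σ : Fin n → Equiv.Perm (Fin 3)) : Fin n → Equiv.Perm (Fin 3) :=
  Function.update σ i (σ i * Equiv.swap 1 2)

lemma exchange_involutive (i : Fin n) : Function.Involutive (exchange i) := by
  intro σ
  simp [exchange, mul_assoc]

lemma sP_exchange (V : Fin n → Fin 3 → Val m) (i : Fin n) (σ : Fin n → Equiv.Perm (Fin 3)) :
    sP V (exchange i σ) = sP V σ := by
  funext k
  by_cases hk : k = i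
  · subst hk
    simp [sP, exchange, Equiv.swap_apply_of_ne_of_ne]
  · simp [sP, exchange, hk]

lemma rP_exchange (V : Fin n → Fin 3 → Val m) (i : Fin n) (σ : Fin n → Equiv.Perm (Fin 3)) :
    rP V (exchange i σ) = Function.update (rP V σ) i (tP V σ i) := by
  funext k
  by_cases hk : k = i
  · subst hk
    simp [rP, tP, exchange]
  · simp [rP, exchange, hk]

lemma tP_exchange (V : Fin n → Fin 3 → Val m) (i : Fin n) (σ : Fin n → Equiv.Perm (Fin 3)) :
    tP V (exchange i σ) = Function.update (tP V σ) i (rP V σ i) := by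
  funext k
  by_cases hk : k = i
  · subst hk
    simp [rP, tP, exchange]
  · simp [tP, exchange, hk]

/-- If buyer `a` has the top bid for `j`, the bids of all other buyers are at most some bid in
the second sample, and bids are distinct, then buyer `a` receives item `j`. -/
lemma top_bid_le_ALGj (d : (Fin m → ℝ) → Val m → Finset (Fin m))
    (asup : Val m → Finset (Fin m) → Fin m → ℝ)
    (p : (Fin n → Val m) → Fin (n + 1) → Fin m → ℝ) (V : Fin n → Fin 3 → Val m)
    (hsup : ∀ i t B, IsSupport (V i t) B (asup (V i t) B))
    (σ : Fin n → Equiv.Perm (Fin 3)) (j : Fin m) (a : Fin n)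
    (hdist : ∀ i, j ∈ Bset d p V σ a → j ∈ Aset d p V σ i →
      asup (rP V σ a) (Bset d p V σ a) j ≠ asup (tP V σ i) (Aset d p V σ i) j)
    (htop : ∀ i, asup (tP V σ i) (Aset d p V σ i) j ≤ asup (rP V σ a) (Bset d p V σ a) j)
    (hother : ∀ i, i ≠ a → ∃ b,
      asup (rP V σ i) (Bset d p V σ i) j ≤ asup (tP V σ b) (Aset d p V σ b) j) :
    asup (rP V σ a) (Bset d p V σ a) j ≤ ALGj d asup p V σ j := by
  have hterm : ∀ i ∈ Finset.univ, 0 ≤ if j ∈ allocSet d asup p V σ i then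
      asup (rP V σ i) (Bset d p V σ i) j else 0 := by
    intro i _
    split_ifs
    · exact (hsup i _ _).1 j
    · exact le_rfl
  rcases ((hsup a _ _).1 j : 0 ≤ asup (rP V σ a) (Bset d p V σ a) j).eq_or_lt with h0 | hpos
  · exact h0 ▸ Finset.sum_nonneg hterm
  have hbase : ∀ i, asup (tP V σ i) (Aset d p V σ i) j ≤ basePrice d asup p V σ j := by
    intro i
    by_cases hi : j ∈ Aset d p V σ i
    · exact le_ciSup (f := fun i : {i : Fin n // j ∈ Aset d p V σ i} =>
        asup (tP V σ i.1) (Aset d p V σ i.1) j) (Set.finite_range _).bddAbove ⟨i, hi⟩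
    · rw [show asup (tP V σ i) (Aset d p V σ i) j = 0 from (hsup i _ _).2.1 j hi]
      exact Real.iSup_nonneg fun k => (hsup k.1 _ _).1 j
  have hmem : j ∈ Bset d p V σ a := by
    by_contra h
    exact hpos.ne' ((hsup a _ _).2.1 j h)
  have hlt : basePrice d asup p V σ j < asup (rP V σ a) (Bset d p V σ a) j := by
    unfold basePrice
    cases isEmpty_or_nonempty {i : Fin n // j ∈ Aset d p V σ i}
    · rwa [Real.iSup_of_isEmpty]
    · obtain ⟨k, hk⟩ := exists_eq_ciSup_of_finite
        (f := fun i : {i : Fin n // j ∈ Aset d p V σ i} =>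
          asup (tP V σ i.1) (Aset d p V σ i.1) j)
      rw [← hk]
      exact (htop k).lt_of_ne (hdist k hmem k.2).symm
  have halloc : j ∈ allocSet d asup p V σ a := by
    refine Finset.mem_filter.2 ⟨Finset.mem_filter.2 ⟨hmem, hlt⟩, fun i hi hj => ?_⟩
    obtain ⟨b, hb⟩ := hother i hi.ne
    exact ((Finset.mem_filter.1 hj).2.trans_le (hb.trans (hbase b))).false
  have := Finset.single_le_sum hterm (Finset.mem_univ a)
  rwa [if_pos halloc] at this

/-- In the two-samples algorithm, assuming all additive supporting
values are distinct, for every item `j` the expected contribution of `j` to the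
algorithm's welfare is at least a quarter of the expectation of the maximum of the
largest `j`-bid in the actual valuations `r` and the largest `j`-bid in the second
sample `s'`; the expectation is over the uniform random assignments `σ` (one
permutation of `{0,1,2}` per buyer, independent across buyers) of the adversary's
three valuation functions per buyer to `s, s', r`. -/
theorem stmt6 (V : Fin n → Fin 3 → Val m)
    (hV : ∀ i t, IsValuation (V i t) ∧ IsXOS (V i t))
    (d : (Fin m → ℝ) → Val m → Finset (Fin m))
    (hd : ∀ q v, IsDemand v q Finset.univ (d q v))
    (asup : Val m → Finset (Fin m) → Fin m → ℝ)
    (hsup : ∀ i t B, IsSupport (V i t) B (asup (V i t) B))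
    (p : (Fin n → Val m) → Fin (n + 1) → Fin m → ℝ)
    (hp0 : ∀ σ j, p (sP V σ) 0 j = 0)
    (hupd : ∀ (σ : Fin n → Equiv.Perm (Fin 3)) (i : Fin n) (j : Fin m),
      p (sP V σ) i.succ j =
        if j ∈ d (p (sP V σ) i.castSucc) (sP V σ i)
        then pow2ceil (asup (sP V σ i) (d (p (sP V σ) i.castSucc) (sP V σ i)) j)
        else p (sP V σ) i.castSucc j)
    (hdist : ∀ (σ : Fin n → Equiv.Perm (Fin 3)) (j' : Fin m) (i i' : Fin n),
      (j' ∈ Bset d p V σ i → j' ∈ Aset d p V σ i' →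
        asup (rP V σ i) (Bset d p V σ i) j' ≠ asup (tP V σ i') (Aset d p V σ i') j') ∧
      (i ≠ i' → j' ∈ Bset d p V σ i → j' ∈ Bset d p V σ i' →
        asup (rP V σ i) (Bset d p V σ i) j' ≠ asup (rP V σ i') (Bset d p V σ i') j') ∧
      (i ≠ i' → j' ∈ Aset d p V σ i → j' ∈ Aset d p V σ i' →
        asup (tP V σ i) (Aset d p V σ i) j' ≠ asup (tP V σ i') (Aset d p V σ i') j'))
    (j : Fin m) :
    (Fintype.card (Fin n → Equiv.Perm (Fin 3)) : ℝ)⁻¹ *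
        ∑ σ : Fin n → Equiv.Perm (Fin 3), ALGj d asup p V σ j ≥
      (1 / 4) *
        ((Fintype.card (Fin n → Equiv.Perm (Fin 3)) : ℝ)⁻¹ *
          ∑ σ : Fin n → Equiv.Perm (Fin 3),
            max (maxR d asup p V σ j) (maxS d asup p V σ j)) := by
  have key : ∑ σ : Fin n → Equiv.Perm (Fin 3), max (maxR d asup p V σ j) (maxS d asup p V σ j) ≤
      4 * ∑ σ : Fin n → Equiv.Perm (Fin 3), ALGj d asup p V σ j := by
    rcases isEmpty_or_nonempty (Fin n) with hn | hn
    · simp [maxR, maxS, ALGj]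
    refine sum_top_bid_le_four_mul_sum exchange exchange_involutive
      (fun σ i => asup (rP V σ i) (Bset d p V σ i) j)
      (fun σ i => asup (tP V σ i) (Aset d p V σ i) j) ?_ ?_ _ _ ?_ ?_ ?_
    · intro i σ
      funext k
      by_cases hk : k = i
      · subst hk
        simp [Bset, Aset, sP_exchange, rP_exchange]
      · simp [Bset, sP_exchange, rP_exchange, hk]
    · intro i σ
      funext k
      by_cases hk : k = i
      · subst hk
        simp [Bset, Aset, sP_exchange, tP_exchange]
      · simp [Aset, sP_exchange, tP_exchange, hk]
    · intro σ
      refine Finset.sum_nonneg fun i _ => ?_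
      split_ifs
      · exact (hsup i _ _).1 j
      · exact le_rfl
    · intro σ x hx
      obtain ⟨i⟩ := hn
      have hx0 : 0 ≤ x := ((hsup i _ _).1 j).trans (hx i).1
      exact max_le (Real.iSup_le (fun k => (hx k).1) hx0) (Real.iSup_le (fun k => (hx k).2) hx0)
    · exact fun σ a htop hother => top_bid_le_ALGj d asup p V hsup σ j a
        (fun i => (hdist σ j a i).1) (fun i => (htop i).2) hother
  have hc : (0 : ℝ) ≤ (Fintype.card (Fin n → Equiv.Perm (Fin 3)) : ℝ)⁻¹ := by positivity
  have := mul_le_mul_of_nonneg_left key hc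
  linarith
end

section
/- Let D be a generic product distribution over profiles of XOS valuations, let α ∈ [0,1/2], and let p be α-median prices for D. Then the expected social welfare of the sequential posted-price mechanism using prices p is at least α times the expected optimal social welfare E[OPT(v)]. -/
open scoped BigOperators

open MeasureTheory
open scoped ENNReal

variable {n m : ℕ}

/-- The set of items still available after the first `i` buyers have bought, in the
sequential posted-price mechanism at prices `q`, where buyer `i` (with valuation
`v i`) buys the bundle `sel i (v i) q M` from the available items `M`. -/
def availN (sel : Fin n → Val m → (Fin m → ℝ) → Finset (Fin m) → Finset (Fin m))
    (q : Fin m → ℝ) (v : Fin n → Val m) : ℕ → Finset (Fin m)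
  | 0 => Finset.univ
  | i + 1 =>
      if h : i < n then
        availN sel q v i \ sel ⟨i, h⟩ (v ⟨i, h⟩) q (availN sel q v i)
      else availN sel q v i

/-- The set of items sold by the sequential posted-price mechanism. -/
def soldSet (sel : Fin n → Val m → (Fin m → ℝ) → Finset (Fin m) → Finset (Fin m))
    (q : Fin m → ℝ) (v : Fin n → Val m) : Finset (Fin m) :=
  Finset.univ \ availN sel q v n

/-- The bundle bought by buyer `i` in the sequential posted-price mechanism. -/
def buys (sel : Fin n → Val m → (Fin m → ℝ) → Finset (Fin m) → Finset (Fin m))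
    (q : Fin m → ℝ) (v : Fin n → Val m) (i : Fin n) : Finset (Fin m) :=
  sel i (v i) q (availN sel q v i.1)

/-- A distribution over single valuations is generic: for every price vector and every
set of available items, with probability zero there exist two distinct demand sets. -/
def Generic1 {m : ℕ} (D : Measure (Val m)) : Prop :=
  ∀ (q : Fin m → ℝ) (M : Finset (Fin m)),
    D {v : Val m | ∃ B1 B2 : Finset (Fin m),
      B1 ≠ B2 ∧ IsDemand v q M B1 ∧ IsDemand v q M B2} = 0

/-- A joint distribution over valuation profiles is generic: each buyer's marginal is
generic. -/
def Generic {n m : ℕ} (D : Measure (Fin n → Val m)) : Prop :=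
  ∀ (i : Fin n) (q : Fin m → ℝ) (M : Finset (Fin m)),
    D {v : Fin n → Val m | ∃ B1 B2 : Finset (Fin m),
      B1 ≠ B2 ∧ IsDemand (v i) q M B1 ∧ IsDemand (v i) q M B2} = 0

/-- Integrating a product of a function of coordinate `i` with a function that does not depend on
coordinate `i` against a product of probability measures. -/
theorem lintegral_pi_mul_eval {ι : Type*} [Fintype ι] [DecidableEq ι] {X : ι → Type*}
    [∀ i, MeasurableSpace (X i)] (μ : ∀ i, Measure (X i)) [∀ i, IsProbabilityMeasure (μ i)]
    (i : ι) {f : (∀ i, X i) → ℝ≥0∞} (hf : Measurable f)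
    (hfi : ∀ x y, f (Function.update x i y) = f x) {g : X i → ℝ≥0∞} (hg : Measurable g) :
    ∫⁻ x, f x * g (x i) ∂Measure.pi μ = (∫⁻ x, f x ∂Measure.pi μ) * ∫⁻ y, g y ∂μ i := by
  have hfg : Measurable fun x : ∀ i, X i => f x * g (x i) :=
    hf.mul (hg.comp (measurable_pi_apply i))
  have hF : Measurable fun x : ∀ i, X i => f x * ∫⁻ y, g y ∂μ i := hf.mul_const _
  have key := lmarginal_eq_of_subset (μ := μ) (Finset.subset_univ {i}) hfg hF (by
    simp [lmarginal_singleton, hfi, lintegral_const_mul _ hg])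
  obtain ⟨x⟩ : Nonempty (∀ i, X i) := nonempty_of_isProbabilityMeasure (Measure.pi μ)
  have := congrFun key x
  simp only [lmarginal_univ] at this
  rw [this, lintegral_mul_const _ hf]

theorem ofReal_sum_le {ι : Type*} (s : Finset ι) (f : ι → ℝ) :
    ENNReal.ofReal (∑ i ∈ s, f i) ≤ ∑ i ∈ s, ENNReal.ofReal (f i) :=
  Finset.le_sum_of_subadditive _ ENNReal.ofReal_zero.le (fun _ _ => ENNReal.ofReal_add_le) _ _

/-- The indirect utility of the valuation `w` at prices `p` when `M` is available, truncated
below at zero. -/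
noncomputable def indirectUtility (p : Fin m → ℝ) (w : Val m) (M : Finset (Fin m)) : ℝ≥0∞ :=
  ⨆ B ∈ M.powerset, ENNReal.ofReal (w B - ∑ j ∈ B, p j)

theorem le_indirectUtility (p : Fin m → ℝ) (w : Val m) {M B : Finset (Fin m)} (h : B ⊆ M) :
    ENNReal.ofReal (w B - ∑ j ∈ B, p j) ≤ indirectUtility p w M :=
  le_iSup₂_of_le B (Finset.mem_powerset.2 h) le_rfl

theorem IsDemand.indirectUtility_eq {p : Fin m → ℝ} {w : Val m} {M B : Finset (Fin m)}
    (h : IsDemand w p M B) :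
    indirectUtility p w M = ENNReal.ofReal (w B - ∑ j ∈ B, p j) :=
  le_antisymm
    (iSup₂_le fun B' hB' => ENNReal.ofReal_le_ofReal (h.2 B' (Finset.mem_powerset.1 hB')))
    (le_indirectUtility p w h.1)

theorem measurable_indirectUtility (p : Fin m → ℝ) (M : Finset (Fin m)) :
    Measurable fun w : Val m => indirectUtility p w M :=
  Measurable.biSup _ (Finset.countable_toSet _) fun B _ =>
    ((measurable_pi_apply B).sub_const _).ennreal_ofReal

/-- The demand set of `w` when it is unique, and `∅` otherwise. -/
noncomputable def uniqueDemand (w : Val m) (q : Fin m → ℝ) (M : Finset (Fin m)) :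
    Finset (Fin m) :=
  open Classical in if h : ∃! B, IsDemand w q M B then h.choose else ∅

theorem uniqueDemand_eq {w : Val m} {q : Fin m → ℝ} {M B : Finset (Fin m)}
    (hB : IsDemand w q M B) (h : ∀ B', IsDemand w q M B' → B' = B) :
    uniqueDemand w q M = B := by
  have hex : ∃! B, IsDemand w q M B := ⟨B, hB, h⟩
  rw [uniqueDemand, dif_pos hex]
  exact h _ hex.choose_spec.1

theorem measurableSet_isDemand (q : Fin m → ℝ) (M B : Finset (Fin m)) :
    MeasurableSet {w : Val m | IsDemand w q M B} := by
  unfold IsDemand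
  refine (MeasurableSet.const _).inter ?_
  have : {w : Val m | ∀ B' ⊆ M, w B' - ∑ j ∈ B', q j ≤ w B - ∑ j ∈ B, q j} =
      ⋂ B', ⋂ _ : B' ⊆ M, {w | w B' - ∑ j ∈ B', q j ≤ w B - ∑ j ∈ B, q j} := by
    ext; simp
  change MeasurableSet {w : Val m | ∀ B' ⊆ M, w B' - ∑ j ∈ B', q j ≤ w B - ∑ j ∈ B, q j}
  rw [this]
  exact MeasurableSet.iInter fun B' => MeasurableSet.iInter fun _ =>
    measurableSet_le ((measurable_pi_apply B').sub_const _) ((measurable_pi_apply B).sub_const _)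

theorem measurableSet_uniqueDemand_eq (q : Fin m → ℝ) (M B : Finset (Fin m)) :
    MeasurableSet {w : Val m | uniqueDemand w q M = B} := by
  have huniq : ∀ B, MeasurableSet
      {w : Val m | IsDemand w q M B ∧ ∀ B', IsDemand w q M B' → B' = B} := by
    intro B
    have : {w : Val m | IsDemand w q M B ∧ ∀ B', IsDemand w q M B' → B' = B} =
        {w | IsDemand w q M B} ∩ ⋂ B', ⋂ _ : B' ≠ B, {w | IsDemand w q M B'}ᶜ := by
      ext w
      simp only [Set.mem_inter_iff, Set.mem_iInter, Set.mem_compl_iff, Set.mem_ofPred_eq]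
      exact and_congr_right fun _ => forall_congr' fun B' => by tauto
    rw [this]
    exact (measurableSet_isDemand q M B).inter (MeasurableSet.iInter fun B' =>
      MeasurableSet.iInter fun _ => (measurableSet_isDemand q M B').compl)
  have : {w : Val m | uniqueDemand w q M = B} =
      {w | IsDemand w q M B ∧ ∀ B', IsDemand w q M B' → B' = B} ∪
        ({w | B = ∅} ∩
          (⋃ C, {w : Val m | IsDemand w q M C ∧ ∀ B', IsDemand w q M B' → B' = C})ᶜ) := by
    ext w
    simp only [Set.mem_union, Set.mem_inter_iff, Set.mem_compl_iff, Set.mem_iUnion,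
      Set.mem_ofPred_eq]
    by_cases h : ∃! C, IsDemand w q M C
    · obtain ⟨C, hC, hC'⟩ := h
      rw [uniqueDemand_eq hC hC']
      constructor
      · rintro rfl
        exact Or.inl ⟨hC, hC'⟩
      · rintro (h | h)
        · exact (hC' _ h.1).symm
        · exact absurd ⟨C, hC, hC'⟩ h.2
    · rw [uniqueDemand, dif_neg h]
      constructor
      · rintro rfl
        exact Or.inr ⟨rfl, h⟩
      · rintro (h' | h')
        · exact absurd ⟨B, h'⟩ h
        · exact h'.1.symm
  rw [this]
  exact (huniq B).union ((MeasurableSet.const _).inter (MeasurableSet.iUnion huniq).compl)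

section Mechanism

variable {sel sel' : Fin n → Val m → (Fin m → ℝ) → Finset (Fin m) → Finset (Fin m)}
  {q : Fin m → ℝ}

theorem availN_congr {v v' : Fin n → Val m} {k : ℕ}
    (h : ∀ i : Fin n, i.1 < k → ∀ M, sel i (v i) q M = sel' i (v' i) q M) :
    availN sel q v k = availN sel' q v' k := by
  induction k with
  | zero => rfl
  | succ k ih =>
    have ih := ih fun i hi => h i (hi.trans k.lt_succ_self)
    by_cases hk : k < n
    · simp only [availN, hk, dif_pos, ih]
      rw [h ⟨k, hk⟩ k.lt_succ_self]
    · simp only [availN, hk, dif_neg, not_false_eq_true, ih]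

theorem availN_antitone (v : Fin n → Val m) : Antitone (availN sel q v) :=
  antitone_nat_of_succ_le fun k => by
    by_cases hk : k < n <;> simp [availN, hk, Finset.sdiff_subset]

theorem measurableSet_availN_eq
    (hsel : ∀ i M B, MeasurableSet {w : Val m | sel i w q M = B}) (k : ℕ) (M : Finset (Fin m)) :
    MeasurableSet {v : Fin n → Val m | availN sel q v k = M} := by
  induction k generalizing M with
  | zero => simp [availN]
  | succ k ih =>
    by_cases hk : k < n
    · have : {v : Fin n → Val m | availN sel q v (k + 1) = M} =
          ⋃ N, ⋃ B, ⋃ _ : N \ B = M, {v | availN sel q v k = N} ∩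
            (fun v : Fin n → Val m => v ⟨k, hk⟩) ⁻¹' {w | sel ⟨k, hk⟩ w q N = B} := by
        ext v
        simp [availN, hk]
      rw [this]
      exact MeasurableSet.iUnion fun N => MeasurableSet.iUnion fun B => MeasurableSet.iUnion
        fun _ => (ih N).inter (measurable_pi_apply _ (hsel _ N B))
    · simpa only [availN, hk, dif_neg, not_false_eq_true] using ih M

/-- The revenue of the mechanism is the total price of the items sold. -/
theorem sum_price_buys (p : Fin m → ℝ) (v : Fin n → Val m)
    (hsub : ∀ i M, sel i (v i) q M ⊆ M) :
    ∑ i, ∑ j ∈ buys sel q v i, p j = ∑ j ∈ soldSet sel q v, p j := by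
  have aux : ∀ k, k ≤ n → ∑ i : Fin n with i.1 < k, ∑ j ∈ buys sel q v i, p j =
      ∑ j ∈ Finset.univ \ availN sel q v k, p j := by
    intro k hk
    induction k with
    | zero => simp [availN]
    | succ k ih =>
      have hk' : k < n := hk
      have hfilter : (Finset.univ.filter fun i : Fin n => i.1 < k + 1) =
          insert ⟨k, hk'⟩ (Finset.univ.filter fun i : Fin n => i.1 < k) := by
        ext i
        simp only [Finset.mem_filter_univ, Finset.mem_insert, Fin.ext_iff]
        omega
      rw [hfilter, Finset.sum_insert (by simp), ih hk'.le]
      simp only [availN, hk', dif_pos, buys]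
      have hs := hsub ⟨k, hk'⟩ (availN sel q v k)
      rw [← Finset.sum_union]
      · congr 1
        ext j
        have := @hs j
        simp only [Finset.mem_union, Finset.mem_sdiff, Finset.mem_univ, true_and]
        tauto
      · exact Finset.disjoint_left.2 fun j hj hj' => (Finset.mem_sdiff.1 hj').2 (hs hj)
  simpa [soldSet] using aux n le_rfl

end Mechanism

/-- If a random set contains each item with probability at least `α`, then an XOS buyer offered
this random set has expected indirect utility at least `α` times the utility of any bundle. -/
theorem IsXOS.mul_le_sum_indirectUtility {w : Val m} (hw : IsXOS w) (p : Fin m → ℝ) {α : ℝ≥0∞}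
    (μ : Finset (Fin m) → ℝ≥0∞) (hμ : ∀ j, α ≤ ∑ M with j ∈ M, μ M) (A : Finset (Fin m)) :
    α * ENNReal.ofReal (w A - ∑ j ∈ A, p j) ≤ ∑ M, μ M * indirectUtility p w M := by
  obtain ⟨k, a, -, hwa⟩ := hw
  obtain ⟨ℓ, hℓ⟩ := exists_eq_ciSup_of_finite (f := fun ℓ => ∑ j ∈ A, a ℓ j)
  have hle : ∀ B, ∑ j ∈ B, a ℓ j ≤ w B := fun B => by
    rw [hwa B]
    exact le_ciSup (f := fun ℓ => ∑ j ∈ B, a ℓ j) (Set.finite_range _).bddAbove ℓ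
  have hpt : ∀ M, ∑ j ∈ A, (if j ∈ M then ENNReal.ofReal (a ℓ j - p j) else 0) ≤
      indirectUtility p w M := by
    intro M
    let B := A.filter fun j => j ∈ M ∧ p j ≤ a ℓ j
    have hB : ∀ j ∈ B, p j ≤ a ℓ j := fun j hj => (Finset.mem_filter.1 hj).2.2
    calc ∑ j ∈ A, (if j ∈ M then ENNReal.ofReal (a ℓ j - p j) else 0)
        = ∑ j ∈ B, ENNReal.ofReal (a ℓ j - p j) := by
          rw [Finset.sum_filter]
          refine Finset.sum_congr rfl fun j _ => ?_
          by_cases hM : j ∈ M <;> by_cases hj : p j ≤ a ℓ j <;> simp [hM, hj]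
          exact (not_le.1 hj).le
      _ = ENNReal.ofReal (∑ j ∈ B, (a ℓ j - p j)) :=
          (ENNReal.ofReal_sum_of_nonneg fun j hj => sub_nonneg.2 (hB j hj)).symm
      _ ≤ ENNReal.ofReal (w B - ∑ j ∈ B, p j) := by
          rw [Finset.sum_sub_distrib]
          exact ENNReal.ofReal_le_ofReal (sub_le_sub_right (hle B) _)
      _ ≤ indirectUtility p w M :=
          le_indirectUtility p w fun j hj => (Finset.mem_filter.1 hj).2.1
  calc α * ENNReal.ofReal (w A - ∑ j ∈ A, p j)
      ≤ α * ∑ j ∈ A, ENNReal.ofReal (a ℓ j - p j) := by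
        gcongr
        rw [hwa A, ← hℓ, ← Finset.sum_sub_distrib]
        exact ofReal_sum_le _ _
    _ ≤ ∑ j ∈ A, (∑ M with j ∈ M, μ M) * ENNReal.ofReal (a ℓ j - p j) := by
        rw [Finset.mul_sum]
        gcongr with j
        exact hμ j
    _ = ∑ M, μ M * ∑ j ∈ A, (if j ∈ M then ENNReal.ofReal (a ℓ j - p j) else 0) := by
        simp_rw [Finset.sum_mul, Finset.sum_filter, Finset.mul_sum]
        rw [Finset.sum_comm]
        simp
    _ ≤ ∑ M, μ M * indirectUtility p w M := by
        gcongr with M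
        exact hpt M

theorem ofReal_OPT_le (p : Fin m → ℝ) (hp : ∀ j, 0 ≤ p j) (v : Fin n → Val m) :
    ∃ A : Fin n → Finset (Fin m), ENNReal.ofReal (OPT v) ≤
      ∑ i, ENNReal.ofReal (v i (A i) - ∑ j ∈ A i, p j) + ∑ j, ENNReal.ofReal (p j) := by
  have : Nonempty {A : Fin n → Finset (Fin m) // IsAlloc A} :=
    ⟨⟨fun _ => ∅, fun _ _ _ => Finset.disjoint_empty_left _⟩⟩
  obtain ⟨⟨A, hA⟩, hopt⟩ := exists_eq_ciSup_of_finite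
    (f := fun A : {A : Fin n → Finset (Fin m) // IsAlloc A} => ∑ i, v i (A.1 i))
  refine ⟨A, ?_⟩
  have hprice : ∑ i, ∑ j ∈ A i, p j ≤ ∑ j, p j := by
    rw [← Finset.sum_biUnion fun i _ i' _ h => hA i i' h]
    exact Finset.sum_le_sum_of_subset_of_nonneg (Finset.subset_univ _) fun j _ _ => hp j
  have hOPT : OPT v ≤ ∑ i, (v i (A i) - ∑ j ∈ A i, p j) + ∑ j, p j := by
    rw [OPT, ← hopt, Finset.sum_sub_distrib]
    linarith
  calc ENNReal.ofReal (OPT v)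
      ≤ ENNReal.ofReal (∑ i, (v i (A i) - ∑ j ∈ A i, p j)) + ENNReal.ofReal (∑ j, p j) :=
        (ENNReal.ofReal_le_ofReal hOPT).trans ENNReal.ofReal_add_le
    _ ≤ _ := by
        rw [ENNReal.ofReal_sum_of_nonneg fun j _ => hp j]
        gcongr
        exact ofReal_sum_le _ _

/-- The state seen by buyer `i` is independent of the valuation of buyer `i`. -/
theorem lintegral_indirectUtility_availN (D : Fin n → Measure (Val m))
    [∀ i, IsProbabilityMeasure (D i)] (p : Fin m → ℝ)
    {sel : Fin n → Val m → (Fin m → ℝ) → Finset (Fin m) → Finset (Fin m)}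
    (hsel : ∀ i M B, MeasurableSet {w : Val m | sel i w p M = B}) (i : Fin n) :
    ∫⁻ v, indirectUtility p (v i) (availN sel p v i) ∂Measure.pi D =
      ∫⁻ v, ∑ M, Measure.pi D {v | availN sel p v i = M} * indirectUtility p (v i) M
        ∂Measure.pi D := by
  have hU := measurable_indirectUtility p
  have hS := measurableSet_availN_eq hsel i
  have hdecomp : ∀ v : Fin n → Val m, indirectUtility p (v i) (availN sel p v i) =
      ∑ M, Set.indicator {v | availN sel p v i = M} 1 v * indirectUtility p (v i) M := by
    intro v
    simp [Set.indicator_apply]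
  have hUi : ∀ M, Measurable fun v : Fin n → Val m => indirectUtility p (v i) M :=
    fun M => (hU M).comp (measurable_pi_apply i)
  have hind : ∀ M, Measurable
      (Set.indicator {v : Fin n → Val m | availN sel p v i = M} (1 : (Fin n → Val m) → ℝ≥0∞)) :=
    fun M => measurable_one.indicator (hS M)
  simp_rw [hdecomp]
  rw [lintegral_finsetSum _ fun M _ => (hind M).fun_mul (hUi M),
    lintegral_finsetSum _ fun M _ => (hUi M).const_mul _]
  refine Finset.sum_congr rfl fun M _ => ?_
  rw [lintegral_const_mul _ (hUi M), lintegral_pi_mul_eval D i (hind M) ?_ (hU M),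
    lintegral_indicator_one (hS M),
    (measurePreserving_eval D i).lintegral_comp (hU M)]
  intro v w
  have : availN sel p (Function.update v i w) i = availN sel p v i :=
    availN_congr fun k hk M => by
      rw [Function.update_of_ne (Fin.ne_of_lt hk)]
  simp [Set.indicator_apply, this]

/-- The welfare of the mechanism splits into the utilities of the buyers and the revenue. -/
theorem ofReal_welfare_eq {p : Fin m → ℝ} (hp : ∀ j, 0 ≤ p j)
    {sel : Fin n → Val m → (Fin m → ℝ) → Finset (Fin m) → Finset (Fin m)} {v : Fin n → Val m}
    (hsel : ∀ i M, IsDemand (v i) p M (sel i (v i) p M)) (hv : ∀ i, v i ∅ = 0) :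
    ENNReal.ofReal (∑ i, v i (buys sel p v i)) =
      ∑ i, indirectUtility p (v i) (availN sel p v i) +
        ∑ j, ENNReal.ofReal (p j) * Set.indicator {v | j ∈ soldSet sel p v} 1 v := by
  have hu : ∀ i, 0 ≤ v i (buys sel p v i) - ∑ j ∈ buys sel p v i, p j := fun i => by
    simpa [hv, buys] using (hsel i (availN sel p v i)).2 ∅ (Finset.empty_subset _)
  have hsplit : ∑ i, v i (buys sel p v i) =
      ∑ i, (v i (buys sel p v i) - ∑ j ∈ buys sel p v i, p j) + ∑ j ∈ soldSet sel p v, p j := by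
    rw [Finset.sum_sub_distrib, sum_price_buys p v fun i M => (hsel i M).1]
    ring
  rw [hsplit, ENNReal.ofReal_add (Finset.sum_nonneg fun i _ => hu i)
    (Finset.sum_nonneg fun j _ => hp j), ENNReal.ofReal_sum_of_nonneg fun i _ => hu i,
    ENNReal.ofReal_sum_of_nonneg fun j _ => hp j]
  congr 1
  · exact Finset.sum_congr rfl fun i _ => (hsel i _).indirectUtility_eq.symm
  · simp [Set.indicator_apply]

/-- Let `D = D_1 × ⋯ × D_n` be a generic product distribution over
profiles of XOS valuations, let `α ∈ [0, 1/2]`, and let `p` be `α`-median prices: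
under the sequential posted-price mechanism at prices `p` (with demand sets chosen by
the rule `sel`), each item sells with probability at most `1 - α`, and each item of
positive price sells with probability at least `α`.  Then the expected social welfare
of the mechanism is at least `α` times the expected optimal social welfare. -/
theorem stmt10 (D : Fin n → Measure (Val m))
    [∀ i, IsProbabilityMeasure (D i)]
    (hval : ∀ i, ∀ᵐ v ∂(D i), IsValuation v ∧ IsXOS v)
    (hgen : ∀ i, Generic1 (D i))
    (α : ℝ) (hα : α ∈ Set.Icc (0 : ℝ) (1 / 2))
    (p : Fin m → ℝ) (hp : ∀ j, 0 ≤ p j)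
    (sel : Fin n → Val m → (Fin m → ℝ) → Finset (Fin m) → Finset (Fin m))
    (hsel : ∀ i v M, IsDemand v p M (sel i v p M))
    (hmedian : ∀ j : Fin m,
      (Measure.pi D) {v : Fin n → Val m | j ∈ soldSet sel p v} ≤ ENNReal.ofReal (1 - α) ∧
      (0 < p j →
        ENNReal.ofReal α ≤ (Measure.pi D) {v : Fin n → Val m | j ∈ soldSet sel p v})) :
    ENNReal.ofReal α * ∫⁻ v, ENNReal.ofReal (OPT v) ∂(Measure.pi D) ≤
      ∫⁻ v, ENNReal.ofReal (∑ i, v i (buys sel p v i)) ∂(Measure.pi D) := by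
  set P := Measure.pi D
  let sel' : Fin n → Val m → (Fin m → ℝ) → Finset (Fin m) → Finset (Fin m) :=
    fun _ => uniqueDemand
  have hmeas : ∀ i M B, MeasurableSet {w : Val m | sel' i w p M = B} :=
    fun _ => measurableSet_uniqueDemand_eq p
  have hae : ∀ᵐ v ∂P, ∀ i, (v i ∅ = 0 ∧ IsXOS (v i)) ∧
      ∀ M, sel i (v i) p M = sel' i (v i) p M := by
    refine ae_all_iff.2 fun i => (measurePreserving_eval D i).quasiMeasurePreserving.ae
      (p := fun w => (w ∅ = 0 ∧ IsXOS w) ∧ ∀ M, sel i w p M = sel' i w p M) ?_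
    have hunique : ∀ᵐ w ∂D i, ∀ M, sel i w p M = sel' i w p M := by
      refine ae_all_iff.2 fun M => measure_mono_null (fun w hw => ?_) (hgen i p M)
      by_contra hcon
      exact hw (uniqueDemand_eq (hsel i w M) fun B' hB' => by_contra fun hne =>
        hcon ⟨B', _, hne, hB', hsel i w M⟩).symm
    filter_upwards [hval i, hunique] with w hw hw' using ⟨⟨hw.1.1, hw.2⟩, hw'⟩
  have havail : ∀ᵐ v ∂P, ∀ k, availN sel p v k = availN sel' p v k := by
    filter_upwards [hae] with v hv k using availN_congr fun i _ => (hv i).2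
  have hS := measurableSet_availN_eq hmeas
  have hsold : ∀ j, MeasurableSet {v : Fin n → Val m | j ∈ soldSet sel' p v} := fun j => by
    have : {v : Fin n → Val m | j ∈ soldSet sel' p v} =
        ⋃ M, ⋃ _ : j ∉ M, {v | availN sel' p v n = M} := by
      ext v
      simp [soldSet]
    rw [this]
    exact MeasurableSet.iUnion fun M => MeasurableSet.iUnion fun _ => hS n M
  have hsold_eq : ∀ j, P {v | j ∈ soldSet sel p v} = P {v | j ∈ soldSet sel' p v} := fun j => by
    refine measure_congr ?_
    filter_upwards [havail] with v hv
    change (j ∈ soldSet sel p v) = (j ∈ soldSet sel' p v)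
    rw [soldSet, soldSet, hv]
  have hprob : ∀ (i : Fin n) j,
      ENNReal.ofReal α ≤ ∑ M with j ∈ M, P {v | availN sel' p v i = M} := fun i j => by
    have hunion : ∑ M with j ∈ M, P {v | availN sel' p v i = M} =
        P {v | j ∈ availN sel' p v i} := by
      rw [← measure_biUnion_finset _ fun M _ => hS i M]
      · congr 1
        ext v
        simp
      · intro M _ N _ hMN
        exact Set.disjoint_left.2 fun v (h : _ = M) (h' : _ = N) => hMN (h.symm.trans h')
    calc ENNReal.ofReal α = 1 - ENNReal.ofReal (1 - α) := by
          rw [← ENNReal.ofReal_one, ← ENNReal.ofReal_sub _ (by linarith [hα.2]), sub_sub_cancel]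
      _ ≤ 1 - P {v | j ∈ soldSet sel' p v} := by
          gcongr
          exact hsold_eq j ▸ (hmedian j).1
      _ = P {v | j ∈ soldSet sel' p v}ᶜ := (prob_compl_eq_one_sub (hsold j)).symm
      _ ≤ P {v | j ∈ availN sel' p v i} := by
          refine measure_mono fun v hv => availN_antitone v i.2.le ?_
          simpa [soldSet] using hv
      _ = _ := hunion.symm
  have hUi : ∀ (i : Fin n) M, Measurable fun v : Fin n → Val m => indirectUtility p (v i) M :=
    fun i M => (measurable_indirectUtility p M).comp (measurable_pi_apply i)
  have hEU : ∀ i : Fin n, Measurable fun v : Fin n → Val m =>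
      ∑ M, P {v | availN sel' p v i = M} * indirectUtility p (v i) M := fun i =>
    Finset.measurable_fun_sum _ fun M _ => (hUi i M).const_mul _
  have hrev : Measurable fun v : Fin n → Val m => ∑ j, ENNReal.ofReal (p j) *
      Set.indicator {v | j ∈ soldSet sel' p v} (1 : (Fin n → Val m) → ℝ≥0∞) v :=
    Finset.measurable_fun_sum _ fun j _ => (measurable_one.indicator (hsold j)).const_mul _
  have hUavail : ∀ i : Fin n, Measurable fun v : Fin n → Val m =>
      indirectUtility p (v i) (availN sel' p v i) := fun i => by
    have : (fun v : Fin n → Val m => indirectUtility p (v i) (availN sel' p v i)) = fun v =>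
        ∑ M, Set.indicator {v | availN sel' p v i = M} (fun v => indirectUtility p (v i) M) v := by
      ext v
      simp [Set.indicator_apply]
    rw [this]
    exact Finset.measurable_fun_sum _ fun M _ => (hUi i M).indicator (hS i M)
  calc ENNReal.ofReal α * ∫⁻ v, ENNReal.ofReal (OPT v) ∂P
      = ∫⁻ v, ENNReal.ofReal α * ENNReal.ofReal (OPT v) ∂P :=
        (lintegral_const_mul' _ _ ENNReal.ofReal_ne_top).symm
    _ ≤ ∫⁻ v, (∑ i : Fin n, ∑ M, P {v | availN sel' p v i = M} * indirectUtility p (v i) M) +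
          ∑ j, ENNReal.ofReal (p j) * P {v | j ∈ soldSet sel' p v} ∂P := by
        refine lintegral_mono_ae ?_
        filter_upwards [hae] with v hv
        obtain ⟨A, hA⟩ := ofReal_OPT_le p hp v
        refine (mul_le_mul_right hA _).trans ?_
        rw [mul_add, Finset.mul_sum, Finset.mul_sum]
        refine add_le_add (Finset.sum_le_sum fun i _ => ?_) (Finset.sum_le_sum fun j _ => ?_)
        · exact (hv i).1.2.mul_le_sum_indirectUtility p _ (hprob i) (A i)
        · rcases (hp j).eq_or_lt with h | h
          · simp [← h]
          · rw [mul_comm, ← hsold_eq]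
            gcongr
            exact (hmedian j).2 h
    _ = ∫⁻ v, (∑ i : Fin n, indirectUtility p (v i) (availN sel' p v i)) +
          ∑ j, ENNReal.ofReal (p j) * Set.indicator {v | j ∈ soldSet sel' p v} 1 v ∂P := by
        rw [lintegral_add_right _ measurable_const, lintegral_add_right _ hrev,
          lintegral_finsetSum _ fun i _ => hEU i, lintegral_finsetSum _ fun i _ => hUavail i,
          lintegral_finsetSum _ fun j _ => (measurable_one.indicator (hsold j)).const_mul _]
        congr 1
        · exact Finset.sum_congr rfl fun i _ =>
            (lintegral_indirectUtility_availN D p hmeas i).symm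
        · rw [lintegral_const, measure_univ, mul_one]
          refine Finset.sum_congr rfl fun j _ => ?_
          rw [lintegral_const_mul _ (measurable_one.indicator (hsold j)),
            lintegral_indicator_one (hsold j)]
    _ = ∫⁻ v, ENNReal.ofReal (∑ i, v i (buys sel p v i)) ∂P := by
        refine lintegral_congr_ae ?_
        filter_upwards [hae, havail] with v hv hav
        rw [ofReal_welfare_eq hp (fun i M => hsel i (v i) M) fun i => (hv i).1.1]
        simp [Set.indicator_apply, soldSet, hav]
end
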